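/- arXiv:2210.11902 — 4 statements merged into one kernel-verified Lean document; each statement's English description precedes it below -/
import Mathlib

section
/- Let d ≥ 1, let ψ be a nonempty finite set of points in ℝ^d, let c : ℝ^d → ℝ satisfy c(y) > 0 for every y ∈ ψ, and let κ : ℝ^d → [0,∞) be a nonnegative function satisfying κ(x) ≤ κ(0) for all x ∈ ℝ^d and κ(0) > 0. Define λ̂_A(x; h) = Σ_{y∈ψ} (h c(y))^{-d} κ((x−y)/(h c(y))) for h > 0 and T(h) = Σ_{x∈ψ} 1/λ̂_A(x; h). Then T(h) → ∞ as h → ∞. -/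
/-- The upper bound of an adaptive kernel estimator vanishes as the bandwidth grows. -/
theorem tendsto_sum_inv_mul_pow_mul_const {ι : Type*} (s : Finset ι) {c : ι → ℝ}
    (hc : ∀ y ∈ s, 0 < c y) {d : ℕ} (hd : d ≠ 0) (K : ℝ) :
    Filter.Tendsto (fun h : ℝ => ∑ y ∈ s, ((h * c y) ^ d)⁻¹ * K) Filter.atTop (nhds 0) := by
  rw [← Finset.sum_const_zero (s := s)]
  refine tendsto_finsetSum s fun y hy => ?_
  rw [← zero_mul K]
  exact (((Filter.tendsto_pow_atTop hd).comp
    (Filter.tendsto_id.atTop_mul_const (hc y hy))).inv_tendsto_atTop).mul_const K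

/-- For a nonnegative kernel maximal at the origin with `κ(0) > 0`,
the Cronie–Van Lieshout criterion function `T(h)` tends to `∞` as `h → ∞`. -/
theorem criterion_tendsto_atTop
    (d : ℕ) (hd : 1 ≤ d)
    (ψ : Finset (EuclideanSpace ℝ (Fin d))) (hψ : ψ.Nonempty)
    (c : EuclideanSpace ℝ (Fin d) → ℝ) (hc : ∀ y ∈ ψ, 0 < c y)
    (κ : EuclideanSpace ℝ (Fin d) → ℝ)
    (hκ_nonneg : ∀ x, 0 ≤ κ x) (hκ_max : ∀ x, κ x ≤ κ 0) (hκ0 : 0 < κ 0)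
    (lamA : EuclideanSpace ℝ (Fin d) → ℝ → ℝ)
    (hlam : ∀ x h, lamA x h =
      ∑ y ∈ ψ, ((h * c y) ^ d)⁻¹ * κ ((h * c y)⁻¹ • (x - y)))
    (T : ℝ → ℝ)
    (hT : ∀ h, T h = ∑ x ∈ ψ, 1 / lamA x h) :
    Filter.Tendsto T Filter.atTop Filter.atTop := by
  have hterm : ∀ x h, 0 < h → ∀ y ∈ ψ,
      0 ≤ ((h * c y) ^ d)⁻¹ * κ ((h * c y)⁻¹ • (x - y)) := fun x h hh y hy =>
    mul_nonneg (inv_nonneg.2 (pow_nonneg (mul_pos hh (hc y hy)).le d)) (hκ_nonneg _)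
  have hpos : ∀ x ∈ ψ, ∀ h, 0 < h → 0 < lamA x h := by
    intro x hx h hh
    rw [hlam]
    refine Finset.sum_pos' (hterm x h hh) ⟨x, hx, ?_⟩
    rw [sub_self, smul_zero]
    exact mul_pos (inv_pos.2 (pow_pos (mul_pos hh (hc x hx)) d)) hκ0
  obtain ⟨x, hx⟩ := hψ
  have hzero : Filter.Tendsto (lamA x) Filter.atTop (nhds 0) := by
    refine squeeze_zero' ?_ ?_
      (tendsto_sum_inv_mul_pow_mul_const ψ hc (Nat.one_le_iff_ne_zero.1 hd) (κ 0))
    · filter_upwards [Filter.eventually_gt_atTop 0] with h hh using (hpos x hx h hh).le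
    · filter_upwards [Filter.eventually_gt_atTop 0] with h hh
      rw [hlam]
      exact Finset.sum_le_sum fun y hy => mul_le_mul_of_nonneg_left (hκ_max _)
        (inv_nonneg.2 (pow_nonneg (mul_pos hh (hc y hy)).le d))
  have hinv : Filter.Tendsto (fun h => (lamA x h)⁻¹) Filter.atTop Filter.atTop := by
    refine Filter.Tendsto.inv_tendsto_nhdsGT_zero
      (tendsto_nhdsWithin_iff.2 ⟨hzero, ?_⟩)
    filter_upwards [Filter.eventually_gt_atTop 0] with h hh using hpos x hx h hh
  refine Filter.tendsto_atTop_mono' _ ?_ hinv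
  filter_upwards [Filter.eventually_gt_atTop 0] with h hh
  rw [hT, ← one_div]
  exact Finset.single_le_sum (f := fun z => 1 / lamA z h)
    (fun z hz => (one_div_pos.2 (hpos z hz h hh)).le) hx
end

section
/- Let d ≥ 1, let ψ be a nonempty finite set of points in ℝ^d, let c : ℝ^d → ℝ satisfy c(y) > 0 for every y ∈ ψ, and let κ be the Gaussian kernel κ(x) = (2π)^{-d/2} exp(-‖x‖²/2). Define λ̂_A(x; h) = Σ_{y∈ψ} (h c(y))^{-d} κ((x−y)/(h c(y))) for h > 0 and T(h) = Σ_{x∈ψ} 1/λ̂_A(x; h). Then for every real number A > 0 there exists h > 0 such that T(h) = A. In particular, for any bounded open window W ⊂ ℝ^d with positive Lebesgue measure ℓ(W), there exists a bandwidth h > 0 solving T(h) = ℓ(W). -/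
open MeasureTheory

/-- For the Gaussian kernel, the Cronie–Van Lieshout criterion function
attains every positive value `A`; in particular, for any bounded open window `W` of
positive Lebesgue measure there is a bandwidth `h > 0` with `T(h) = ℓ(W)`. -/
theorem criterion_attains_every_positive_value_gaussian
    (d : ℕ) (hd : 1 ≤ d)
    (ψ : Finset (EuclideanSpace ℝ (Fin d))) (hψ : ψ.Nonempty)
    (c : EuclideanSpace ℝ (Fin d) → ℝ) (hc : ∀ y ∈ ψ, 0 < c y)
    (κ : EuclideanSpace ℝ (Fin d) → ℝ)
    (hκ : ∀ x, κ x = (2 * Real.pi) ^ (-(d : ℝ) / 2) * Real.exp (-‖x‖ ^ 2 / 2))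
    (lamA : EuclideanSpace ℝ (Fin d) → ℝ → ℝ)
    (hlam : ∀ x h, lamA x h =
      ∑ y ∈ ψ, ((h * c y) ^ d)⁻¹ * κ ((h * c y)⁻¹ • (x - y)))
    (T : ℝ → ℝ)
    (hT : ∀ h, T h = ∑ x ∈ ψ, 1 / lamA x h) :
    (∀ A : ℝ, 0 < A → ∃ h > (0 : ℝ), T h = A) ∧
    (∀ W : Set (EuclideanSpace ℝ (Fin d)), IsOpen W → Bornology.IsBounded W →
      0 < volume W → ∃ h > (0 : ℝ), T h = (volume W).toReal) := by
  have hκ_pos : ∀ x, 0 < κ x := fun x ↦ by rw [hκ]; positivity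
  have hκ_le : ∀ x, κ x ≤ κ 0 := fun x ↦ by
    rw [hκ, hκ 0]
    gcongr
    simp
  have hκ_cont : Continuous κ := by
    rw [funext hκ]
    fun_prop
  have hterm_pos : ∀ x, ∀ y ∈ ψ, ∀ h : ℝ, 0 < h →
      0 < ((h * c y) ^ d)⁻¹ * κ ((h * c y)⁻¹ • (x - y)) := fun x y hy h hh ↦
    mul_pos (inv_pos.2 (pow_pos (mul_pos hh (hc y hy)) d)) (hκ_pos _)
  have hlam_pos : ∀ x, ∀ h : ℝ, 0 < h → 0 < lamA x h := fun x h hh ↦ by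
    rw [hlam]
    exact Finset.sum_pos (fun y hy ↦ hterm_pos x y hy h hh) hψ
  have hT_cont : ContinuousOn T (Set.Ioi 0) := by
    rw [funext hT]
    refine continuousOn_finsetSum _ fun x _ ↦
      continuousOn_const.div ?_ fun h hh ↦ (hlam_pos x h hh).ne'
    rw [funext (hlam x)]
    refine continuousOn_finsetSum _ fun y hy ↦ ?_
    have hne : ∀ h ∈ Set.Ioi (0 : ℝ), h * c y ≠ 0 := fun h hh ↦
      (mul_pos (Set.mem_Ioi.1 hh) (hc y hy)).ne'
    have hmul : ContinuousOn (fun h : ℝ ↦ h * c y) (Set.Ioi 0) := by fun_prop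
    exact ((hmul.pow d).inv₀ fun h hh ↦ pow_ne_zero d (hne h hh)).mul
      (hκ_cont.comp_continuousOn ((hmul.inv₀ hne).smul continuousOn_const))
  have hT_zero : Filter.Tendsto T (nhdsWithin 0 (Set.Ioi 0)) (nhds 0) := by
    rw [funext hT]
    suffices hsummand : ∀ x ∈ ψ,
        Filter.Tendsto (fun h ↦ 1 / lamA x h) (nhdsWithin 0 (Set.Ioi 0)) (nhds 0) by
      simpa only [Finset.sum_const_zero] using tendsto_finsetSum ψ hsummand
    intro x hx
    have hlim : Filter.Tendsto (fun h : ℝ ↦ (h * c x) ^ d / κ 0)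
        (nhdsWithin 0 (Set.Ioi 0)) (nhds 0) := by
      have hcont : Continuous fun h : ℝ ↦ (h * c x) ^ d / κ 0 := by fun_prop
      have := hcont.tendsto 0
      rw [zero_mul, zero_pow (by omega), zero_div] at this
      exact this.mono_left nhdsWithin_le_nhds
    refine tendsto_of_tendsto_of_tendsto_of_le_of_le' tendsto_const_nhds hlim ?_ ?_
    · filter_upwards [self_mem_nhdsWithin] with h hh
      exact (one_div_pos.2 (hlam_pos x h hh)).le
    · filter_upwards [self_mem_nhdsWithin] with h hh
      have hle : ((h * c x) ^ d)⁻¹ * κ 0 ≤ lamA x h := by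
        rw [hlam]
        simpa using Finset.single_le_sum (fun y hy ↦ (hterm_pos x y hy h hh).le) hx
      have hpos : 0 < ((h * c x) ^ d)⁻¹ * κ 0 :=
        mul_pos (inv_pos.2 (pow_pos (mul_pos hh (hc x hx)) d)) (hκ_pos 0)
      calc 1 / lamA x h ≤ 1 / (((h * c x) ^ d)⁻¹ * κ 0) := one_div_le_one_div_of_le hpos hle
        _ = (h * c x) ^ d / κ 0 := by rw [one_div, mul_inv, inv_inv, div_eq_mul_inv]
  have hlam_zero : ∀ x, Filter.Tendsto (lamA x) Filter.atTop (nhds 0) := fun x ↦ by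
    rw [funext (hlam x), ← Finset.sum_const_zero (s := ψ)]
    refine tendsto_finsetSum _ fun y hy ↦ ?_
    have hlim : Filter.Tendsto (fun h : ℝ ↦ ((h * c y) ^ d)⁻¹ * κ 0) Filter.atTop (nhds 0) := by
      have := (tendsto_inv_atTop_zero.comp ((Filter.tendsto_pow_atTop (by omega : d ≠ 0)).comp
        (Filter.tendsto_id.atTop_mul_const (hc y hy)))).mul_const (κ 0)
      rwa [zero_mul] at this
    refine tendsto_of_tendsto_of_tendsto_of_le_of_le' tendsto_const_nhds hlim ?_ ?_
    · filter_upwards [Filter.eventually_gt_atTop 0] with h hh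
      exact (hterm_pos x y hy h hh).le
    · filter_upwards [Filter.eventually_gt_atTop 0] with h hh
      exact mul_le_mul_of_nonneg_left (hκ_le _)
        (inv_pos.2 (pow_pos (mul_pos hh (hc y hy)) d)).le
  have hT_top : Filter.Tendsto T Filter.atTop Filter.atTop := by
    obtain ⟨x, hx⟩ := hψ
    have hinv : Filter.Tendsto (fun h ↦ (lamA x h)⁻¹) Filter.atTop Filter.atTop :=
      tendsto_inv_nhdsGT_zero.comp (tendsto_nhdsWithin_iff.2
        ⟨hlam_zero x, (Filter.eventually_gt_atTop 0).mono (hlam_pos x)⟩)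
    refine Filter.tendsto_atTop_mono' _ ?_ hinv
    filter_upwards [Filter.eventually_gt_atTop 0] with h hh
    rw [hT, ← one_div]
    exact Finset.single_le_sum (f := fun x ↦ 1 / lamA x h)
      (fun z _ ↦ (one_div_pos.2 (hlam_pos z h hh)).le) hx
  have hsurj : ∀ A : ℝ, 0 < A → ∃ h > (0 : ℝ), T h = A := fun A hA ↦
    isPreconnected_Ioi.intermediate_value_Ioi
      (Filter.le_principal_iff.2 self_mem_nhdsWithin)
      (Filter.le_principal_iff.2 (Filter.Ioi_mem_atTop 0))
      hT_cont hT_zero hT_top hA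
  exact ⟨hsurj, fun W _ hW hW_pos ↦
    hsurj _ (ENNReal.toReal_pos hW_pos.ne' hW.measure_lt_top.ne)⟩
end

section
/- Let d ≥ 1, let ψ be a nonempty finite set of points in ℝ^d, let c : ℝ^d → ℝ satisfy c(y) > 0 for every y ∈ ψ, let γ > 0 be real, and let κ^γ be the Beta kernel κ^γ(x) = (Γ(d/2+γ+1)/(π^{d/2} Γ(γ+1))) (1−‖x‖²)^γ · 1{‖x‖ ≤ 1}. Define λ̂_A(x; h) = Σ_{y∈ψ} (h c(y))^{-d} κ^γ((x−y)/(h c(y))) for h > 0 and T(h) = Σ_{x∈ψ} 1/λ̂_A(x; h). Then for every real number A > 0 there exists h > 0 such that T(h) = A. -/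
section AdaptiveKernel

variable {E : Type*} [NormedAddCommGroup E] [NormedSpace ℝ E]

/-- The Abramson adaptive kernel estimator with kernel `κ` and local scaling factors `c`. -/
noncomputable def abramsonEstimator (d : ℕ) (ψ : Finset E) (c κ : E → ℝ) (x : E) (h : ℝ) : ℝ :=
  ∑ y ∈ ψ, ((h * c y) ^ d)⁻¹ * κ ((h * c y)⁻¹ • (x - y))

variable {d : ℕ} {ψ : Finset E} {c κ : E → ℝ} {x : E} {h : ℝ}

lemma le_abramsonEstimator (hc : ∀ y ∈ ψ, 0 < c y) (hnonneg : ∀ x, 0 ≤ κ x)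
    (hx : x ∈ ψ) (hh : 0 < h) :
    ((h * c x) ^ d)⁻¹ * κ 0 ≤ abramsonEstimator d ψ c κ x h := by
  have hterm : ∀ y ∈ ψ, 0 ≤ ((h * c y) ^ d)⁻¹ * κ ((h * c y)⁻¹ • (x - y)) := fun y hy => by
    have := hc y hy
    have := hnonneg ((h * c y)⁻¹ • (x - y))
    positivity
  simpa [abramsonEstimator] using Finset.single_le_sum hterm hx

lemma abramsonEstimator_pos (hc : ∀ y ∈ ψ, 0 < c y) (hnonneg : ∀ x, 0 ≤ κ x)
    (hpos : 0 < κ 0) (hx : x ∈ ψ) (hh : 0 < h) : 0 < abramsonEstimator d ψ c κ x h := by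
  have := hc x hx
  exact lt_of_lt_of_le (by positivity) (le_abramsonEstimator hc hnonneg hx hh)

lemma abramsonEstimator_le (hc : ∀ y ∈ ψ, 0 < c y) (hle : ∀ x, κ x ≤ κ 0) (hh : 0 < h) :
    abramsonEstimator d ψ c κ x h ≤ (h ^ d)⁻¹ * ∑ y ∈ ψ, (c y ^ d)⁻¹ * κ 0 := by
  rw [abramsonEstimator, Finset.mul_sum]
  refine Finset.sum_le_sum fun y hy => ?_
  have := hc y hy
  rw [← mul_assoc, ← mul_inv, ← mul_pow]
  exact mul_le_mul_of_nonneg_left (hle _) (by positivity)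

lemma continuousOn_abramsonEstimator (hc : ∀ y ∈ ψ, 0 < c y) (hκ : Continuous κ) :
    ContinuousOn (abramsonEstimator d ψ c κ x) (Set.Ioi 0) := by
  refine continuousOn_finsetSum _ fun y hy => ?_
  have hne : ∀ h ∈ Set.Ioi (0 : ℝ), h * c y ≠ 0 := fun h hh =>
    (mul_pos hh (hc y hy)).ne'
  have hmul : ContinuousOn (fun h : ℝ => h * c y) (Set.Ioi 0) := by fun_prop
  exact ((hmul.pow d).inv₀ fun h hh => pow_ne_zero d (hne h hh)).mul
    (hκ.comp_continuousOn ((hmul.inv₀ hne).smul continuousOn_const))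

/-- For a continuous nonnegative kernel that is maximal and positive at the origin, the
Cronie–Van Lieshout criterion function attains every positive value. -/
theorem exists_sum_one_div_abramsonEstimator_eq (hd : d ≠ 0) (hψ : ψ.Nonempty)
    (hc : ∀ y ∈ ψ, 0 < c y) (hκ : Continuous κ) (hnonneg : ∀ x, 0 ≤ κ x)
    (hle : ∀ x, κ x ≤ κ 0) (hpos : 0 < κ 0) {A : ℝ} (hA : 0 < A) :
    ∃ h > (0 : ℝ), ∑ x ∈ ψ, 1 / abramsonEstimator d ψ c κ x h = A := by
  have exists_scale : ∀ K : ℝ, 0 < K → ∃ h > (0 : ℝ), h ^ d * K = A := fun K hK =>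
    ⟨(A / K) ^ ((d : ℝ)⁻¹), by positivity, by
      rw [Real.rpow_inv_natCast_pow (by positivity) hd]; field_simp⟩
  have hupper : 0 < ∑ x ∈ ψ, c x ^ d / κ 0 := Finset.sum_pos (fun x hx => by
    have := hc x hx
    positivity) hψ
  have hsum : 0 < ∑ y ∈ ψ, (c y ^ d)⁻¹ * κ 0 := Finset.sum_pos (fun y hy => by
    have := hc y hy
    positivity) hψ
  have hlower : 0 < ∑ _x ∈ ψ, 1 / ∑ y ∈ ψ, (c y ^ d)⁻¹ * κ 0 :=
    Finset.sum_pos (fun _ _ => by positivity) hψ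
  obtain ⟨a, ha, haA⟩ := exists_scale _ hupper
  obtain ⟨b, hb, hbA⟩ := exists_scale _ hlower
  have hcont : ContinuousOn (fun h => ∑ x ∈ ψ, 1 / abramsonEstimator d ψ c κ x h)
      (Set.Ioi 0) :=
    continuousOn_finsetSum _ fun x hx => continuousOn_const.div
      (continuousOn_abramsonEstimator hc hκ)
      fun h hh => (abramsonEstimator_pos hc hnonneg hpos hx hh).ne'
  refine isPreconnected_Ioi.intermediate_value ha hb hcont ⟨?_, ?_⟩
  · rw [← haA, Finset.mul_sum]
    refine Finset.sum_le_sum fun x hx => ?_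
    have := hc x hx
    calc 1 / abramsonEstimator d ψ c κ x a ≤ 1 / (((a * c x) ^ d)⁻¹ * κ 0) :=
          one_div_le_one_div_of_le (by positivity) (le_abramsonEstimator hc hnonneg hx ha)
      _ = a ^ d * (c x ^ d / κ 0) := by rw [mul_pow]; field_simp
  · rw [← hbA, Finset.mul_sum]
    refine Finset.sum_le_sum fun x hx => ?_
    calc b ^ d * (1 / ∑ y ∈ ψ, (c y ^ d)⁻¹ * κ 0)
        = 1 / ((b ^ d)⁻¹ * ∑ y ∈ ψ, (c y ^ d)⁻¹ * κ 0) := by field_simp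
      _ ≤ 1 / abramsonEstimator d ψ c κ x b :=
          one_div_le_one_div_of_le (abramsonEstimator_pos hc hnonneg hpos hx hb)
            (abramsonEstimator_le hc hle hb)

end AdaptiveKernel

lemma ite_norm_le_one_eq_max_rpow {E : Type*} [SeminormedAddCommGroup E] {γ : ℝ} (hγ : γ ≠ 0)
    (C : ℝ) (x : E) :
    (if ‖x‖ ≤ 1 then C * (1 - ‖x‖ ^ 2) ^ γ else 0) = C * (max 0 (1 - ‖x‖ ^ 2)) ^ γ := by
  split_ifs with hx
  · rw [max_eq_right (by nlinarith [norm_nonneg x])]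
  · rw [max_eq_left (by nlinarith [norm_nonneg x]), Real.zero_rpow hγ, mul_zero]

/-- For the Beta kernel with parameter `γ > 0`, the Cronie–Van Lieshout
criterion function attains every positive value `A`. -/
theorem criterion_attains_every_positive_value_beta
    (d : ℕ) (hd : 1 ≤ d)
    (ψ : Finset (EuclideanSpace ℝ (Fin d))) (hψ : ψ.Nonempty)
    (c : EuclideanSpace ℝ (Fin d) → ℝ) (hc : ∀ y ∈ ψ, 0 < c y)
    (γ : ℝ) (hγ : 0 < γ)
    (κ : EuclideanSpace ℝ (Fin d) → ℝ)
    (hκ : ∀ x, κ x =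
      if ‖x‖ ≤ 1 then
        (Real.Gamma ((d : ℝ) / 2 + γ + 1) /
          (Real.pi ^ ((d : ℝ) / 2) * Real.Gamma (γ + 1))) * (1 - ‖x‖ ^ 2) ^ γ
      else 0)
    (lamA : EuclideanSpace ℝ (Fin d) → ℝ → ℝ)
    (hlam : ∀ x h, lamA x h =
      ∑ y ∈ ψ, ((h * c y) ^ d)⁻¹ * κ ((h * c y)⁻¹ • (x - y)))
    (T : ℝ → ℝ)
    (hT : ∀ h, T h = ∑ x ∈ ψ, 1 / lamA x h) :
    ∀ A : ℝ, 0 < A → ∃ h > (0 : ℝ), T h = A := by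
  have hC : 0 < Real.Gamma ((d : ℝ) / 2 + γ + 1) /
      (Real.pi ^ ((d : ℝ) / 2) * Real.Gamma (γ + 1)) :=
    div_pos (Real.Gamma_pos_of_pos (by positivity))
      (mul_pos (by positivity) (Real.Gamma_pos_of_pos (by positivity)))
  set C := Real.Gamma ((d : ℝ) / 2 + γ + 1) /
    (Real.pi ^ ((d : ℝ) / 2) * Real.Gamma (γ + 1))
  have hκ_eq : κ = fun x => C * (max 0 (1 - ‖x‖ ^ 2)) ^ γ :=
    funext fun x => (hκ x).trans (ite_norm_le_one_eq_max_rpow hγ.ne' C x)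
  have hκ_zero : κ 0 = C := by simp [hκ_eq]
  have hcont : Continuous κ := by
    rw [hκ_eq]
    exact continuous_const.mul
      (Continuous.rpow_const (by fun_prop) fun _ => Or.inr hγ.le)
  have hnonneg : ∀ x, 0 ≤ κ x := fun x => by
    rw [hκ_eq]
    positivity
  have hle : ∀ x, κ x ≤ κ 0 := fun x => by
    rw [hκ_zero, hκ_eq]
    refine mul_le_of_le_one_right hC.le (Real.rpow_le_one (le_max_left _ _) ?_ hγ.le)
    exact max_le zero_le_one (sub_le_self _ (by positivity))
  intro A hA
  obtain ⟨h, hh, heq⟩ := exists_sum_one_div_abramsonEstimator_eq (Nat.one_le_iff_ne_zero.mp hd)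
    hψ hc hcont hnonneg hle (hκ_zero ▸ hC) hA
  refine ⟨h, hh, ?_⟩
  rw [hT, ← heq]
  exact Finset.sum_congr rfl fun x _ => by rw [hlam, abramsonEstimator]
end

section
/- Let d ≥ 1, let ψ be a nonempty finite set of points in ℝ^d, let c : ℝ^d → ℝ satisfy c(y) > 0 for every y ∈ ψ, and let κ⁰ be the box kernel κ⁰(x) = (Γ(d/2+1)/π^{d/2}) · 1{‖x‖ ≤ 1}. Define λ̂_A(x; h) = Σ_{y∈ψ} (h c(y))^{-d} κ⁰((x−y)/(h c(y))) for h > 0 and T(h) = Σ_{x∈ψ} 1/λ̂_A(x; h). Then T is continuous at every h in (0, ∞) outside the finite set D = {‖x − y‖ / c(y) : x ∈ ψ, y ∈ ψ, x ≠ y}; i.e. T is continuous on (0, ∞) \ D. -/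
open Filter Topology in
/-- A threshold function of `g` is continuous wherever `g` is continuous and off the threshold. -/
theorem ContinuousAt.ite_le_const {X Y : Type*} [TopologicalSpace X] [TopologicalSpace Y]
    {g : X → ℝ} {a : X} {r : ℝ} (hg : ContinuousAt g a) (hr : g a ≠ r) (u v : Y) :
    ContinuousAt (fun t => if g t ≤ r then u else v) a := by
  rcases lt_or_gt_of_ne hr with h | h
  · refine (continuousAt_const (y := u)).congr ?_
    filter_upwards [hg.eventually (gt_mem_nhds h)] with t ht
    rw [if_pos ht.le]
  · refine (continuousAt_const (y := v)).congr ?_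
    filter_upwards [hg.eventually (lt_mem_nhds h)] with t ht
    rw [if_neg ht.not_ge]

/-- For the box kernel, the Cronie–Van Lieshout criterion function `T`
is continuous at every bandwidth `h ∈ (0, ∞)` outside the exceptional set
`D = {‖x − y‖ / c(y) : x, y ∈ ψ, x ≠ y}`. -/
theorem criterion_piecewise_continuous_box
    (d : ℕ) (hd : 1 ≤ d)
    (ψ : Finset (EuclideanSpace ℝ (Fin d))) (hψ : ψ.Nonempty)
    (c : EuclideanSpace ℝ (Fin d) → ℝ) (hc : ∀ y ∈ ψ, 0 < c y)
    (κ : EuclideanSpace ℝ (Fin d) → ℝ)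
    (hκ : ∀ x, κ x =
      if ‖x‖ ≤ 1 then Real.Gamma ((d : ℝ) / 2 + 1) / Real.pi ^ ((d : ℝ) / 2) else 0)
    (lamA : EuclideanSpace ℝ (Fin d) → ℝ → ℝ)
    (hlam : ∀ x h, lamA x h =
      ∑ y ∈ ψ, ((h * c y) ^ d)⁻¹ * κ ((h * c y)⁻¹ • (x - y)))
    (T : ℝ → ℝ)
    (hT : ∀ h, T h = ∑ x ∈ ψ, 1 / lamA x h)
    (D : Set ℝ)
    (hD : D = {t : ℝ | ∃ x ∈ ψ, ∃ y ∈ ψ, x ≠ y ∧ t = ‖x - y‖ / c y}) :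
    ∀ h ∈ Set.Ioi (0 : ℝ) \ D, ContinuousAt T h := by
  rintro h ⟨hh, hhD⟩
  replace hh : 0 < h := hh
  have hK : 0 < Real.Gamma ((d : ℝ) / 2 + 1) / Real.pi ^ ((d : ℝ) / 2) :=
    div_pos (Real.Gamma_pos_of_pos (by positivity)) (Real.rpow_pos_of_pos Real.pi_pos _)
  have hκ_nonneg : ∀ z, 0 ≤ κ z := fun z => by
    rw [hκ]
    split_ifs
    exacts [hK.le, le_rfl]
  have hlam_pos : ∀ x ∈ ψ, 0 < lamA x h := fun x hx => by
    rw [hlam]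
    refine Finset.sum_pos' (fun y hy => ?_) ⟨x, hx, ?_⟩
    · have := mul_pos hh (hc y hy)
      exact mul_nonneg (by positivity) (hκ_nonneg _)
    · have := mul_pos hh (hc x hx)
      have hκ0 : 0 < κ ((h * c x)⁻¹ • (x - x)) := by simpa [hκ] using hK
      positivity
  have hlam_cont : ∀ x ∈ ψ, ContinuousAt (lamA x) h := fun x hx => by
    rw [funext (hlam x)]
    refine tendsto_finsetSum _ fun y hy => ?_
    have hne : h * c y ≠ 0 := (mul_pos hh (hc y hy)).ne'
    have hmul : ContinuousAt (fun t => t * c y) h := continuousAt_id.mul continuousAt_const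
    refine ContinuousAt.mul ((hmul.pow d).inv₀ (pow_ne_zero d hne)) ?_
    simp only [hκ]
    refine ((hmul.inv₀ hne).smul continuousAt_const).norm.ite_le_const (fun heq => hhD ?_) _ _
    replace heq : ‖(h * c y)⁻¹ • (x - y)‖ = 1 := heq
    rw [hD]
    refine ⟨x, hx, y, hy, fun hxy => by simp [hxy] at heq, ?_⟩
    rw [norm_smul, norm_inv, Real.norm_of_nonneg (mul_pos hh (hc y hy)).le,
      inv_mul_eq_one₀ hne] at heq
    rw [← heq, mul_div_cancel_right₀ _ (hc y hy).ne']
  rw [funext hT]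
  exact tendsto_finsetSum _ fun x hx =>
    continuousAt_const.div (hlam_cont x hx) (hlam_pos x hx).ne'
end
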